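/- Let C_1, …, C_N be nonempty closed convex subsets of a real Hilbert space E with C := ⋂_{i=1}^N C_i ≠ ∅, and let P_i denote the metric projection onto C_i. Given x_0 ∈ E, define the averaged projection sequence x_n := (1/N) Σ_{i=1}^N P_i x_{n−1} for n ≥ 1. Then (x_n)_{n≥0} converges weakly to some element x* ∈ C. -/

import Mathlib

open RealInnerProductSpace Filter

section

variable {E : Type*} [NormedAddCommGroup E] [InnerProductSpace ℝ E]

/-- The obtuse-angle characterization of a nearest point of a convex set. -/
theorem inner_sub_nearest_le_zero {K : Set E} (hK : Convex ℝ K) {u v : E} (hv : v ∈ K)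
    (hmin : ∀ y ∈ K, ‖u - v‖ ≤ ‖u - y‖) {w : E} (hw : w ∈ K) : ⟪u - v, w - v⟫ ≤ 0 := by
  refine (norm_eq_iInf_iff_real_inner_le_zero hK hv).1 ?_ w hw
  have : Nonempty K := ⟨⟨v, hv⟩⟩
  refine le_antisymm (le_ciInf fun y => hmin y y.2) ?_
  exact ciInf_le (f := fun y : K => ‖u - y‖) ⟨0, by rintro _ ⟨y, rfl⟩; exact norm_nonneg _⟩ ⟨v, hv⟩

theorem norm_nearest_sub_sq_add_le {K : Set E} (hK : Convex ℝ K) {u v : E} (hv : v ∈ K)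
    (hmin : ∀ y ∈ K, ‖u - v‖ ≤ ‖u - y‖) {w : E} (hw : w ∈ K) :
    ‖v - w‖ ^ 2 + ‖u - v‖ ^ 2 ≤ ‖u - w‖ ^ 2 := by
  have h := inner_sub_nearest_le_zero hK hv hmin hw
  have e := norm_sub_sq_real (u - v) (w - v)
  rw [sub_sub_sub_cancel_right, norm_sub_rev w v] at e
  linarith

theorem norm_average_sub_sq_le {N : ℕ} (hN : 0 < N) (p : Fin N → E) (c : E) :
    ‖(N : ℝ)⁻¹ • ∑ i, p i - c‖ ^ 2 ≤ (N : ℝ)⁻¹ * ∑ i, ‖p i - c‖ ^ 2 := by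
  have hN' : (0 : ℝ) < N := by exact_mod_cast hN
  have e : (N : ℝ)⁻¹ • ∑ i, p i - c = (N : ℝ)⁻¹ • ∑ i, (p i - c) := by
    rw [Finset.sum_sub_distrib, smul_sub, Finset.sum_const, Finset.card_univ, Fintype.card_fin,
      ← Nat.cast_smul_eq_nsmul ℝ, inv_smul_smul₀ hN'.ne']
  have h₁ : ‖∑ i, (p i - c)‖ ^ 2 ≤ N * ∑ i, ‖p i - c‖ ^ 2 := by
    calc ‖∑ i, (p i - c)‖ ^ 2 ≤ (∑ i, ‖p i - c‖) ^ 2 := by gcongr; exact norm_sum_le _ _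
      _ ≤ N * ∑ i, ‖p i - c‖ ^ 2 := by
        simpa using sq_sum_le_card_mul_sum_sq (s := Finset.univ) (f := fun i => ‖p i - c‖)
  rw [e, norm_smul, mul_pow, norm_inv, Real.norm_natCast]
  calc (N : ℝ)⁻¹ ^ 2 * ‖∑ i, (p i - c)‖ ^ 2
      ≤ (N : ℝ)⁻¹ ^ 2 * (N * ∑ i, ‖p i - c‖ ^ 2) := by gcongr
    _ = (N : ℝ)⁻¹ * ∑ i, ‖p i - c‖ ^ 2 := by field_simp

/-- A bounded family in a Hilbert space has a weak limit along every ultrafilter. -/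
theorem exists_weak_limit_of_bounded [CompleteSpace E] {ι : Type*} (U : Ultrafilter ι)
    {x : ι → E} {R : ℝ} (hx : ∀ n, ‖x n‖ ≤ R) :
    ∃ z : E, ∀ y : E, Tendsto (fun n => ⟪x n, y⟫) U (nhds ⟪z, y⟫) := by
  let f : ι → WeakDual ℝ E := fun n => StrongDual.toWeakDual (InnerProductSpace.toDual ℝ E (x n))
  have hf : ∀ n, f n ∈ WeakDual.toStrongDual ⁻¹'
      Metric.closedBall (0 : StrongDual ℝ E) R := fun n => by
    simpa [f] using hx n
  obtain ⟨φ, -, hφ⟩ := (WeakDual.isCompact_closedBall (0 : StrongDual ℝ E) R).ultrafilter_le_nhds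
    (U.map f) (le_principal_iff.2 (Filter.mem_map.2 (Filter.univ_mem' hf)))
  refine ⟨(InnerProductSpace.toDual ℝ E).symm (WeakDual.toStrongDual φ), fun y => ?_⟩
  rw [InnerProductSpace.toDual_symm_apply]
  exact ((WeakDual.eval_continuous y).tendsto φ).comp hφ

/-- The uniqueness part of Opial's lemma: two weak limits of `x` along ultrafilters coincide if the
distances from `x n` to both of them converge. -/
theorem weak_limit_unique_of_tendsto_norm_sub {x : ℕ → E} {z w : E} {a b : ℝ}
    {U V : Ultrafilter ℕ} (hU : (U : Filter ℕ) ≤ atTop) (hV : (V : Filter ℕ) ≤ atTop)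
    (hz : ∀ y : E, Tendsto (fun n => ⟪x n, y⟫) U (nhds ⟪z, y⟫))
    (hw : ∀ y : E, Tendsto (fun n => ⟪x n, y⟫) V (nhds ⟪w, y⟫))
    (ha : Tendsto (fun n => ‖x n - z‖ ^ 2) atTop (nhds a))
    (hb : Tendsto (fun n => ‖x n - w‖ ^ 2) atTop (nhds b)) : z = w := by
  have h : Tendsto (fun n => ⟪x n, z - w⟫) atTop
      (nhds ((b - a + ‖z‖ ^ 2 - ‖w‖ ^ 2) / 2)) := by
    refine ((((hb.sub ha).add_const _).sub_const _).div_const 2).congr fun n => ?_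
    rw [norm_sub_sq_real, norm_sub_sq_real, inner_sub_right]
    ring
  have e₁ := tendsto_nhds_unique (hz (z - w)) (h.mono_left hU)
  have e₂ := tendsto_nhds_unique (hw (z - w)) (h.mono_left hV)
  rw [← sub_eq_zero, ← inner_self_eq_zero (𝕜 := ℝ), inner_sub_left, e₁, e₂, sub_self]

/-- If `x` converges weakly to `z` and the distance from `x` to its nearest points in `K` tends to
zero, then `z ∈ K`. -/
theorem weak_limit_mem_of_tendsto_sub_nearest {ι : Type*} {l : Filter ι} [l.NeBot] {K : Set E}
    (hK : Convex ℝ K) {P : E → E} (hP : ∀ x, P x ∈ K ∧ ∀ y ∈ K, ‖x - P x‖ ≤ ‖x - y‖)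
    {x : ι → E} {z : E} (hz : ∀ y : E, Tendsto (fun n => ⟪x n, y⟫) l (nhds ⟪z, y⟫))
    (h0 : Tendsto (fun n => x n - P (x n)) l (nhds 0)) : z ∈ K := by
  have h : Tendsto (fun n => ⟪z - P z, P (x n) - P z⟫) l (nhds ⟪z - P z, z - P z⟫) := by
    have h₁ := ((hz (z - P z)).sub (h0.inner (tendsto_const_nhds (x := z - P z)))).sub_const
      ⟪P z, z - P z⟫
    rw [inner_zero_left, sub_zero, ← inner_sub_left] at h₁
    refine h₁.congr fun n => ?_
    rw [← inner_sub_left, ← inner_sub_left, sub_sub_cancel, real_inner_comm]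
  have h₂ : ⟪z - P z, z - P z⟫ ≤ 0 := le_of_tendsto' h fun n =>
    inner_sub_nearest_le_zero hK (hP z).1 (hP z).2 (hP (x n)).1
  rw [sub_eq_zero.1 (inner_self_eq_zero.1 (h₂.antisymm real_inner_self_nonneg))]
  exact (hP z).1

end

theorem averaged_projections_weak_convergence
    {E : Type*} [NormedAddCommGroup E] [InnerProductSpace ℝ E] [CompleteSpace E]
    (N : ℕ) (hN : 0 < N) (C : Fin N → Set E)
    (hCne : ∀ i, (C i).Nonempty) (hCc : ∀ i, IsClosed (C i))
    (hCv : ∀ i, Convex ℝ (C i))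
    (hinter : (⋂ i, C i).Nonempty)
    (P : Fin N → E → E)
    (hP : ∀ i, ∀ x : E, P i x ∈ C i ∧ ∀ y ∈ C i, ‖x - P i x‖ ≤ ‖x - y‖)
    (x₀ : E) (x : ℕ → E) (hx0 : x 0 = x₀)
    (hx : ∀ n : ℕ, x (n + 1) = (N : ℝ)⁻¹ • ∑ i, P i (x n)) :
    ∃ xstar ∈ ⋂ i, C i,
      ∀ y : E, Tendsto (fun n => ⟪x n, y⟫) atTop (nhds ⟪xstar, y⟫) := by
  have hN' : (0 : ℝ) < N := by exact_mod_cast hN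
  have fejer : ∀ c ∈ ⋂ i, C i, ∀ n,
      ‖x (n + 1) - c‖ ^ 2 + (N : ℝ)⁻¹ * ∑ i, ‖x n - P i (x n)‖ ^ 2 ≤ ‖x n - c‖ ^ 2 := by
    intro c hc n
    have h₁ := norm_average_sub_sq_le hN (fun i => P i (x n)) c
    rw [← hx n] at h₁
    have h₂ : ∑ i, (‖P i (x n) - c‖ ^ 2 + ‖x n - P i (x n)‖ ^ 2) ≤ ∑ _i : Fin N, ‖x n - c‖ ^ 2 :=
      Finset.sum_le_sum fun i _ => norm_nearest_sub_sq_add_le (hCv i) (hP i _).1 (hP i _).2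
        (Set.mem_iInter.1 hc i)
    rw [Finset.sum_add_distrib, Finset.sum_const, Finset.card_univ, Fintype.card_fin,
      nsmul_eq_mul] at h₂
    have h₃ := mul_le_mul_of_nonneg_left h₂ (inv_pos.2 hN').le
    rw [inv_mul_cancel_left₀ hN'.ne', mul_add] at h₃
    linarith
  have anti : ∀ c ∈ ⋂ i, C i, Antitone fun n => ‖x n - c‖ ^ 2 := fun c hc =>
    antitone_nat_of_succ_le fun n => by
      have := fejer c hc n
      have : 0 ≤ (N : ℝ)⁻¹ * ∑ i, ‖x n - P i (x n)‖ ^ 2 := by positivity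
      linarith
  have conv : ∀ c ∈ ⋂ i, C i, ∃ a, Tendsto (fun n => ‖x n - c‖ ^ 2) atTop (nhds a) :=
    fun c hc => ⟨_, tendsto_atTop_ciInf (anti c hc)
      ⟨0, by rintro _ ⟨n, rfl⟩; exact sq_nonneg _⟩⟩
  obtain ⟨c, hc⟩ := hinter
  have hres : ∀ i, Tendsto (fun n => x n - P i (x n)) atTop (nhds 0) := by
    intro i
    obtain ⟨a, ha⟩ := conv c hc
    have h₁ := (ha.sub (ha.comp (tendsto_add_atTop_nat 1))).const_mul (N : ℝ)
    rw [sub_self, mul_zero] at h₁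
    have h₂ : Tendsto (fun n => ‖x n - P i (x n)‖ ^ 2) atTop (nhds 0) := by
      refine squeeze_zero (fun n => sq_nonneg _) (fun n => ?_) h₁
      have h₃ := Finset.single_le_sum (f := fun j => ‖x n - P j (x n)‖ ^ 2)
        (fun j _ => sq_nonneg _) (Finset.mem_univ i)
      refine h₃.trans ?_
      rw [← inv_mul_le_iff₀ hN']
      have := fejer c hc n
      simp only [Function.comp_apply]
      linarith
    rw [tendsto_zero_iff_norm_tendsto_zero]
    simpa [Real.sqrt_sq] using h₂.sqrt
  have bdd : ∀ n, ‖x n‖ ≤ ‖x 0 - c‖ + ‖c‖ := fun n => by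
    have h₁ : ‖x n - c‖ ≤ ‖x 0 - c‖ :=
      (sq_le_sq₀ (norm_nonneg _) (norm_nonneg _)).1 (anti c hc (Nat.zero_le n))
    have h₂ := norm_add_le (x n - c) c
    rw [sub_add_cancel] at h₂
    linarith
  have key : ∀ U : Ultrafilter ℕ, (U : Filter ℕ) ≤ atTop →
      ∃ z ∈ ⋂ i, C i, ∀ y : E, Tendsto (fun n => ⟪x n, y⟫) U (nhds ⟪z, y⟫) := by
    intro U hU
    obtain ⟨z, hz⟩ := exists_weak_limit_of_bounded U bdd
    exact ⟨z, Set.mem_iInter.2 fun i => weak_limit_mem_of_tendsto_sub_nearest (hCv i) (hP i) hz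
      ((hres i).mono_left hU), hz⟩
  obtain ⟨z, hzC, hz⟩ := key (Ultrafilter.of atTop) (Ultrafilter.of_le _)
  refine ⟨z, hzC, fun y => tendsto_iff_ultrafilter _ _ _ |>.2 fun V hV => ?_⟩
  obtain ⟨w, hwC, hw⟩ := key V hV
  obtain ⟨a, ha⟩ := conv z hzC
  obtain ⟨b, hb⟩ := conv w hwC
  rw [weak_limit_unique_of_tendsto_norm_sub (Ultrafilter.of_le _) hV hz hw ha hb]
  exact hw y
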